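/- There exists ε > 0 such that for all real x with |x| < ε, F(1/6, -1/6; 1/4; 27·x·(x+1)^4 / (2(x^2+4x+1)^3)) = (1+2x)^(1/4) / (1+4x+x^2)^(1/2). -/

import Mathlib

open Real

/-- The Gauss hypergeometric series `F(a,b;c;z) = ∑ ((a)_n (b)_n / ((c)_n n!)) z^n`,
where `(q)_n` is the rising (Pochhammer) factorial. -/
noncomputable def hypgeo (a b c z : ℝ) : ℝ :=
  ∑' n : ℕ, ((∏ i ∈ Finset.range n, (a + i)) * (∏ i ∈ Finset.range n, (b + i)) /
    ((∏ i ∈ Finset.range n, (c + i)) * (Nat.factorial n))) * z ^ n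

/-- A power series with polynomially bounded coefficients is summable on the open unit interval. -/
theorem summable_mul_pow_of_abs_le {c : ℕ → ℝ} {C : ℝ} {k : ℕ}
    (hc : ∀ n, |c n| ≤ C * (n + 1) ^ k) {z : ℝ} (hz : |z| < 1) :
    Summable fun n => c n * z ^ n := by
  rcases eq_or_ne z 0 with rfl | hz0
  · refine summable_of_ne_finset_zero (s := {0}) fun n hn => ?_
    simp_all
  have h1 : Summable fun n : ℕ => ((n + 1 : ℕ) : ℝ) ^ k * |z| ^ (n + 1) :=
    (summable_nat_add_iff 1).2
      (summable_pow_mul_geometric_of_norm_lt_one k (r := |z|) (by simpa using hz))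
  have hz0' : |z| ≠ 0 := abs_ne_zero.2 hz0
  refine Summable.of_norm_bounded (h1.mul_left (C * |z|⁻¹)) fun n => ?_
  rw [norm_mul, norm_pow, norm_eq_abs, norm_eq_abs]
  calc |c n| * |z| ^ n ≤ C * (n + 1) ^ k * |z| ^ n := by gcongr; exact hc n
    _ = _ := by push_cast; field_simp; ring

theorem abs_succ_mul_le {c : ℕ → ℝ} {C : ℝ} {k : ℕ} (hc : ∀ n, |c n| ≤ C * (n + 1) ^ k) (n : ℕ) :
    |((n : ℝ) + 1) * c (n + 1)| ≤ C * 2 ^ k * (n + 1) ^ (k + 1) := by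
  have hC : 0 ≤ C := by simpa using (abs_nonneg _).trans (hc 0)
  rw [abs_mul, abs_of_nonneg (by positivity : (0 : ℝ) ≤ n + 1)]
  calc ((n : ℝ) + 1) * |c (n + 1)| ≤ (n + 1) * (C * ((n + 1 : ℕ) + 1) ^ k) := by
        gcongr; exact hc _
    _ ≤ (n + 1) * (C * (2 * (n + 1)) ^ k) := by
        gcongr; push_cast; linarith [(Nat.cast_nonneg n : (0 : ℝ) ≤ n)]
    _ = _ := by rw [mul_pow]; ring

/-- A power series with polynomially bounded coefficients may be differentiated termwise on the
open unit interval. -/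
theorem hasDerivAt_tsum_mul_pow {c : ℕ → ℝ} {C : ℝ} {k : ℕ}
    (hc : ∀ n, |c n| ≤ C * (n + 1) ^ k) {z : ℝ} (hz : |z| < 1) :
    HasDerivAt (fun y => ∑' n, c n * y ^ n) (∑' n : ℕ, (n + 1) * c (n + 1) * z ^ n) z := by
  obtain ⟨r, hzr, hr1⟩ := exists_between hz
  have hr0 : 0 ≤ r := (abs_nonneg z).trans hzr.le
  have hd := abs_succ_mul_le hc
  have hu : Summable fun n : ℕ => |c n| * (n * r ^ (n - 1)) := by
    rw [← summable_nat_add_iff 1]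
    refine (summable_mul_pow_of_abs_le (fun n => (abs_abs _).trans_le (hd n))
      (by rwa [abs_of_nonneg hr0])).congr fun n => ?_
    rw [abs_mul, abs_of_nonneg (by positivity : (0 : ℝ) ≤ n + 1)]
    simp
    ring
  have hbound : ∀ n : ℕ, ∀ y ∈ Metric.ball (0 : ℝ) r,
      ‖c n * (n * y ^ (n - 1))‖ ≤ |c n| * (n * r ^ (n - 1)) := fun n y hy => by
    rw [mem_ball_zero_iff] at hy
    rw [norm_mul, norm_mul, norm_pow, norm_eq_abs, RCLike.norm_natCast]
    gcongr
  have hzb : z ∈ Metric.ball (0 : ℝ) r := by simpa using hzr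
  have key := hasDerivAt_tsum_of_isPreconnected (g := fun n y => c n * y ^ n) hu
    Metric.isOpen_ball (convex_ball (0 : ℝ) r).isPreconnected
    (fun n y _ => (hasDerivAt_pow n y).const_mul (c n)) hbound hzb
    (summable_mul_pow_of_abs_le hc hz) hzb
  refine key.congr_deriv ?_
  rw [(Summable.of_norm_bounded hu fun n => hbound n z hzb).tsum_eq_zero_add]
  simp only [Nat.cast_zero, zero_mul, mul_zero, zero_add, Nat.add_sub_cancel]
  refine tsum_congr fun n => ?_
  push_cast
  ring

theorem HasSum.mul_pow_of_succ {g : ℕ → ℝ} {z S : ℝ}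
    (h : HasSum (fun n => g (n + 1) * z ^ n) S) (h0 : g 0 = 0) :
    HasSum (fun n => g n * z ^ n) (z * S) := by
  rw [← hasSum_nat_add_iff' 1]
  simpa [h0, pow_succ', mul_left_comm] using h.mul_left z

/-- The coefficients of the Gauss hypergeometric series. -/
noncomputable def hypgeoCoeff (a b c : ℝ) (n : ℕ) : ℝ :=
  ((∏ i ∈ Finset.range n, (a + i)) * (∏ i ∈ Finset.range n, (b + i))) /
    ((∏ i ∈ Finset.range n, (c + i)) * (Nat.factorial n))

theorem hypgeoCoeff_zero (a b c : ℝ) : hypgeoCoeff a b c 0 = 1 := by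
  simp [hypgeoCoeff]

theorem hypgeoCoeff_succ (a b : ℝ) {c : ℝ} (hc : 0 < c) (n : ℕ) :
    hypgeoCoeff a b c (n + 1) =
      hypgeoCoeff a b c n * ((a + n) * (b + n) / ((c + n) * (n + 1))) := by
  have h1 : ∏ i ∈ Finset.range n, (c + i) ≠ 0 := Finset.prod_ne_zero_iff.2 fun i _ => by positivity
  have h2 : c + n ≠ 0 := by positivity
  have h3 : (n.factorial : ℝ) ≠ 0 := by positivity
  simp only [hypgeoCoeff, Finset.prod_range_succ, Nat.factorial_succ]
  push_cast
  field_simp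

/-- The hypergeometric differential equation. -/
theorem hypgeo_ode {a b c : ℝ} (hc : 0 < c) {C : ℝ} {k : ℕ}
    (hbd : ∀ n, |hypgeoCoeff a b c n| ≤ C * (n + 1) ^ k) :
    ∃ f₁ f₂ : ℝ → ℝ, ∀ z : ℝ, |z| < 1 →
      HasDerivAt (hypgeo a b c) (f₁ z) z ∧ HasDerivAt f₁ (f₂ z) z ∧
      z * (1 - z) * f₂ z + (c - (a + b + 1) * z) * f₁ z - a * b * hypgeo a b c z = 0 := by
  set α := hypgeoCoeff a b c with hα
  have hbd₁ := abs_succ_mul_le hbd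
  have hbd₂ := abs_succ_mul_le hbd₁
  refine ⟨fun z => ∑' n : ℕ, (n + 1) * α (n + 1) * z ^ n,
    fun z => ∑' n : ℕ, (n + 1) * (((n + 1 : ℕ) + 1) * α (n + 1 + 1)) * z ^ n, fun z hz =>
    ⟨hasDerivAt_tsum_mul_pow hbd hz, hasDerivAt_tsum_mul_pow hbd₁ hz, ?_⟩⟩
  have H0 : HasSum (fun n => α n * z ^ n) (hypgeo a b c z) :=
    (summable_mul_pow_of_abs_le hbd hz).hasSum
  have H1 := (summable_mul_pow_of_abs_le hbd₁ hz).hasSum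
  have H2 := (summable_mul_pow_of_abs_le hbd₂ hz).hasSum
  dsimp only
  generalize ∑' n : ℕ, ((n : ℝ) + 1) * α (n + 1) * z ^ n = S₁ at H1 ⊢
  generalize ∑' n : ℕ, ((n : ℝ) + 1) * (((n + 1 : ℕ) + 1) * α (n + 1 + 1)) * z ^ n = S₂ at H2 ⊢
  have zH1 := HasSum.mul_pow_of_succ (g := fun n => n * α n) (by simpa using H1) (by simp)
  have zH2 := HasSum.mul_pow_of_succ (g := fun n : ℕ => n * ((n + 1) * α (n + 1)))
    (by simpa using H2) (by simp)
  have zzH2 := HasSum.mul_pow_of_succ (g := fun n : ℕ => n * ((n - 1) * α n))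
    (S := z * S₂)
    (by convert zH2 using 3 with n; push_cast; ring) (by simp)
  have H := (((zH2.sub zzH2).add (H1.mul_left c)).sub (zH1.mul_left (a + b + 1))).sub
    (H0.mul_left (a * b))
  refine Eq.trans ?_ (H.unique ((hasSum_zero (α := ℝ)).congr_fun fun n => ?_))
  · ring
  · have h1 : c + n ≠ 0 := by positivity
    have h2 : (n : ℝ) + 1 ≠ 0 := by positivity
    rw [hα, hypgeoCoeff_succ a b hc]
    field_simp
    ring

/-- A solution of `x * E' = s * E` with `s < 0` near `0` vanishes. -/
theorem eq_zero_of_mul_deriv_eq {E e s : ℝ → ℝ} {ε : ℝ}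
    (hE : ∀ x, |x| < ε → HasDerivAt E (e x) x)
    (he : ∀ x, |x| < ε → x * e x = s x * E x) (hs : ∀ x, |x| < ε → s x < 0)
    {x : ℝ} (hx : |x| < ε) : E x = 0 := by
  have h0 : |(0 : ℝ)| < ε := by simpa using (abs_nonneg x).trans_lt hx
  have hE0 : E 0 = 0 := by
    have := he 0 h0
    simpa [(hs 0 h0).ne] using this
  have hmem : ∀ t ∈ Set.Icc (0 : ℝ) 1, |t * x| < ε := fun t ht => by
    rw [abs_mul, abs_of_nonneg ht.1]
    exact (mul_le_of_le_one_left (abs_nonneg x) ht.2).trans_lt hx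
  have hd : ∀ t ∈ Set.Icc (0 : ℝ) 1,
      HasDerivAt (fun t => E (t * x) ^ 2) (2 * E (t * x) * (e (t * x) * x)) t := fun t ht => by
    have := ((hE _ (hmem t ht)).comp t (hasDerivAt_mul_const x)).pow 2
    refine this.congr_deriv ?_
    simp
  have hanti : AntitoneOn (fun t => E (t * x) ^ 2) (Set.Icc 0 1) := by
    refine antitoneOn_of_deriv_nonpos (convex_Icc 0 1)
      (fun t ht => (hd t ht).continuousAt.continuousWithinAt)
      (fun t ht => (hd t (interior_subset ht)).differentiableAt.differentiableWithinAt)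
      fun t ht => ?_
    rw [(hd t (interior_subset ht)).deriv]
    rw [interior_Icc] at ht
    have h := hmem t (Set.Ioo_subset_Icc_self ht)
    refine nonpos_of_mul_nonpos_right (a := t) ?_ ht.1
    have : t * (2 * E (t * x) * (e (t * x) * x)) = 2 * s (t * x) * E (t * x) ^ 2 := by
      linear_combination 2 * E (t * x) * he _ h
    rw [this]
    nlinarith [hs _ h, sq_nonneg (E (t * x))]
  have := hanti (Set.left_mem_Icc.2 zero_le_one) (Set.right_mem_Icc.2 zero_le_one) zero_le_one
  simp only [one_mul, zero_mul, hE0] at this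
  nlinarith

theorem abs_hypgeoCoeff_le_one (n : ℕ) : |hypgeoCoeff (1/6) (-1/6) (1/4) n| ≤ 1 := by
  induction n with
  | zero => simp [hypgeoCoeff_zero]
  | succ n ih =>
    rw [hypgeoCoeff_succ _ _ (by norm_num), abs_mul]
    refine mul_le_one₀ ih (abs_nonneg _) ?_
    have hn : (0 : ℝ) ≤ n := n.cast_nonneg
    have hpos : (0 : ℝ) < (1 / 4 + n) * (n + 1) := by positivity
    rw [abs_le, le_div_iff₀ hpos, div_le_iff₀ hpos]
    constructor <;> nlinarith

theorem abs_modular_argument_lt_one {x : ℝ} (hx : |x| < 1 / 100) :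
    |27 * x * (x + 1)^4 / (2 * (x^2 + 4*x + 1)^3)| < 1 := by
  obtain ⟨h1, h2⟩ := abs_lt.1 hx
  have hq : 9 / 10 < x ^ 2 + 4 * x + 1 := by nlinarith
  have hq3 : (9 / 10) ^ 3 < (x ^ 2 + 4 * x + 1) ^ 3 := by gcongr
  have hp : (x + 1) ^ 4 < (102 / 100) ^ 4 := by gcongr <;> linarith
  rw [abs_div, abs_mul, abs_mul, abs_of_nonneg (by positivity : 0 ≤ (x + 1) ^ 4),
    abs_of_pos (by positivity : 0 < 2 * (x ^ 2 + 4 * x + 1) ^ 3), div_lt_one (by positivity)]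
  have : |(27 : ℝ)| * |x| * (x + 1) ^ 4 ≤ 27 * (1 / 100) * (102 / 100) ^ 4 := by
    rw [abs_of_pos (by norm_num : (0 : ℝ) < 27)]
    gcongr
  refine this.trans_lt ?_
  linarith

theorem stmt12 : ∃ ε > 0, ∀ x : ℝ, |x| < ε →
    hypgeo (1/6) (-1/6) (1/4) (27 * x * (x + 1)^4 / (2 * (x^2 + 4*x + 1)^3)) =
      (1 + 2*x) ^ ((1 : ℝ)/4) / (1 + 4*x + x^2) ^ ((1 : ℝ)/2) := by
  refine ⟨1 / 100, by norm_num, fun x hx => ?_⟩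
  obtain ⟨f₁, f₂, hf⟩ := hypgeo_ode (a := 1/6) (b := -1/6) (c := 1/4) (C := 1) (k := 0)
    (by norm_num) (by simpa using abs_hypgeoCoeff_le_one)
  set F := hypgeo (1/6) (-1/6) (1/4) with hF
  set Z : ℝ → ℝ := fun x => 27 * x * (x + 1)^4 / (2 * (x^2 + 4*x + 1)^3) with hZ
  have hpos : ∀ y : ℝ, |y| < 1 / 100 → 0 < y ^ 2 + 4 * y + 1 ∧ 0 < 1 + 2 * y ∧ 0 < 2 + y :=
    fun y hy => by
      obtain ⟨h1, h2⟩ := abs_lt.1 hy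
      exact ⟨by nlinarith, by linarith, by linarith⟩
  have hq' : ∀ y : ℝ, HasDerivAt (fun y : ℝ => y ^ 2 + 4 * y + 1) (2 * y + 4) y := fun y => by
    simpa using ((hasDerivAt_pow 2 y).add ((hasDerivAt_id y).const_mul 4)).add_const 1
  have hZ' : ∀ y : ℝ, |y| < 1 / 100 → HasDerivAt Z
      (27 / 2 * (y + 1) ^ 3 * (1 - y) ^ 3 / (y ^ 2 + 4 * y + 1) ^ 4) y := fun y hy => by
    obtain ⟨hq, -, -⟩ := hpos y hy
    have := (((hasDerivAt_id y).const_mul 27).mul (((hasDerivAt_id y).add_const 1).pow 4)).div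
      (((hq' y).pow 3).const_mul 2) (by simp only [Pi.pow_apply]; positivity)
    refine this.congr_deriv ?_
    simp only [id, Pi.pow_apply, Pi.mul_apply]
    rw [div_eq_div_iff (by positivity) (by positivity)]
    ring
  have hFZ : ∀ y : ℝ, |y| < 1 / 100 → HasDerivAt (fun y => F (Z y))
      (f₁ (Z y) * (27 / 2 * (y + 1) ^ 3 * (1 - y) ^ 3 / (y ^ 2 + 4 * y + 1) ^ 4)) y :=
    fun y hy => (hf (Z y) (abs_modular_argument_lt_one hy)).1.comp y (hZ' y hy)
  have hfZ : ∀ y : ℝ, |y| < 1 / 100 → HasDerivAt (fun y => f₁ (Z y))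
      (f₂ (Z y) * (27 / 2 * (y + 1) ^ 3 * (1 - y) ^ 3 / (y ^ 2 + 4 * y + 1) ^ 4)) y :=
    fun y hy => (hf (Z y) (abs_modular_argument_lt_one hy)).2.1.comp y (hZ' y hy)
  set U : ℝ → ℝ := fun y => 9 * (1 + y) * (1 - y) ^ 3 * (1 + 2 * y) / (y ^ 2 + 4 * y + 1) ^ 3
    with hU
  set U' : ℝ → ℝ := fun y => 9 * (((1 - y) ^ 3 * (1 + 2 * y) - 3 * (1 + y) * (1 - y) ^ 2 * (1 + 2 * y)
      + 2 * (1 + y) * (1 - y) ^ 3) * (y ^ 2 + 4 * y + 1)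
      - (1 + y) * (1 - y) ^ 3 * (1 + 2 * y) * (3 * (2 * y + 4))) / (y ^ 2 + 4 * y + 1) ^ 4 with hU'
  have hdU : ∀ y : ℝ, |y| < 1 / 100 → HasDerivAt U (U' y) y := fun y hy => by
    obtain ⟨hq, -, -⟩ := hpos y hy
    have := ((((((hasDerivAt_id y).const_add 1).const_mul 9).mul
      (((hasDerivAt_id y).const_sub 1).pow 3)).mul
      (((hasDerivAt_id y).const_mul 2).const_add 1))).div ((hq' y).pow 3)
      (by simp only [Pi.pow_apply]; positivity)
    refine this.congr_deriv ?_
    simp only [id, Pi.pow_apply, Pi.mul_apply, hU']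
    rw [div_eq_div_iff (by positivity) (by positivity)]
    ring
  have hE : ∀ y : ℝ, |y| < 1 / 100 → U y * f₁ (Z y) + F (Z y) = 0 := fun y hy => by
    refine eq_zero_of_mul_deriv_eq (E := fun y => U y * f₁ (Z y) + F (Z y))
      (s := fun y => -((1 - y) ^ 2 / (2 * (y ^ 2 + 4 * y + 1) * (2 + y))))
      (fun t ht => ((hdU t ht).mul (hfZ t ht)).add (hFZ t ht))
      (fun t ht => ?_) (fun t ht => ?_) hy
    · obtain ⟨hq, h1, h2⟩ := hpos t ht
      have hode := (hf (Z t) (abs_modular_argument_lt_one ht)).2.2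
      change t * ((U' t * f₁ (Z t) + U t * (f₂ (Z t) * _)) + f₁ (Z t) * _) = _
      change Z t * (1 - Z t) * f₂ (Z t) + _ * f₁ (Z t) - _ * F (Z t) = 0 at hode
      have hZt : Z t = 27 * t * (t + 1)^4 / (2 * (t^2 + 4*t + 1)^3) := rfl
      generalize f₁ (Z t) = A at *
      generalize f₂ (Z t) = B at *
      generalize F (Z t) = D at *
      rw [hZt] at hode
      simp only [hU, hU']
      have hq := hq.ne'
      obtain ⟨q, hqt⟩ : ∃ q, q = t ^ 2 + 4 * t + 1 := ⟨_, rfl⟩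
      rw [← hqt] at hq hode ⊢
      have h2 := h2.ne'
      linear_combination (norm := skip) (18 * (1 - t) ^ 2 / (q * (2 + t))) * hode
      field_simp
      rw [hqt]
      ring
    · obtain ⟨hq, h1, h2⟩ := hpos t ht
      have : 0 < 1 - t := by linarith [(abs_lt.1 ht).2]
      simp only [neg_lt_zero]
      positivity
  have hφ : ∀ y : ℝ, |y| < 1 / 100 → HasDerivAt
      (fun y => F (Z y) * ((1 + 2 * y) ^ (-(1 / 4) : ℝ) * (y ^ 2 + 4 * y + 1) ^ (1 / 2 : ℝ))) 0 y :=
    fun y hy => by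
    obtain ⟨hq, h1, h2⟩ := hpos y hy
    have d1 := (((hasDerivAt_id y).const_mul 2).const_add 1).rpow_const
      (p := (-(1 / 4) : ℝ)) (Or.inl h1.ne')
    have d2 := (hq' y).rpow_const (p := (1 / 2 : ℝ)) (Or.inl hq.ne')
    have := (hFZ y hy).mul (d1.mul d2)
    refine this.congr_deriv ?_
    simp only [id, Pi.mul_apply]
    rw [rpow_sub_one h1.ne', rpow_sub_one hq.ne']
    have hEy := hE y hy
    simp only [hU] at hEy
    generalize f₁ (Z y) = A at *
    generalize F (Z y) = D at *
    generalize (1 + 2 * y) ^ (-(1 / 4) : ℝ) = P at *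
    generalize (y ^ 2 + 4 * y + 1) ^ (1 / 2 : ℝ) = Q at *
    have hq := hq.ne'
    have h1 := h1.ne'
    obtain ⟨q, hqy⟩ : ∃ q, q = y ^ 2 + 4 * y + 1 := ⟨_, rfl⟩
    rw [← hqy] at hq hEy ⊢
    linear_combination (norm := skip) (3 * (y + 1) ^ 2 / (2 * (1 + 2 * y) * q)) * P * Q * hEy
    field_simp
    rw [hqy]
    ring
  have hball : ∀ y ∈ Metric.ball (0 : ℝ) (1 / 100), |y| < 1 / 100 := fun y hy => by
    simpa using hy
  have h := Metric.isOpen_ball.is_const_of_deriv_eq_zero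
    (convex_ball (0 : ℝ) (1 / 100)).isPreconnected
    (fun y hy => (hφ y (hball y hy)).differentiableAt.differentiableWithinAt)
    (fun y hy => (hφ y (hball y hy)).deriv)
    (x := x) (y := 0) (by simpa using hx) (by simp)
  obtain ⟨hq, h1, -⟩ := hpos x hx
  have hF0 : F 0 = 1 := by
    rw [hF, hypgeo, tsum_eq_single 0 fun n hn => by simp [hn]]
    simp
  have hZ0 : Z 0 = 0 := by simp [hZ]
  change F (Z x) = _
  have hconst : F (Z x) * ((1 + 2 * x) ^ (-(1 / 4) : ℝ) * (x ^ 2 + 4 * x + 1) ^ (1 / 2 : ℝ)) = 1 :=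
    h.trans (by simp [hZ0, hF0])
  rw [rpow_neg h1.le] at hconst
  rw [show 1 + 4 * x + x ^ 2 = x ^ 2 + 4 * x + 1 by ring]
  have hP := (rpow_pos_of_pos h1 (1 / 4 : ℝ)).ne'
  have hQ := (rpow_pos_of_pos hq (1 / 2 : ℝ)).ne'
  rw [eq_div_iff hQ]
  generalize (1 + 2 * x) ^ (1 / 4 : ℝ) = P at *
  generalize (x ^ 2 + 4 * x + 1) ^ (1 / 2 : ℝ) = Q at *
  linear_combination P * hconst - F (Z x) * Q * mul_inv_cancel₀ hP
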